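/- Given an azygetic 4-tuple q₁,q₂,q₃,q₄ of odd quadratic forms completed by q₅,q₆,q₇ to an Aronhold system, the Jacobian determinants of theta gradients at z=0 satisfy D[q₄,q₂,q₃]/D[q₁,q₂,q₃] = −e((q₅+q₆+q₇)'·(q₁+q₄)'') · θ(q₅+q₆+q₁)θ(q₅+q₇+q₁)θ(q₆+q₇+q₁) / (θ(q₅+q₆+q₄)θ(q₅+q₇+q₄)θ(q₆+q₇+q₄)), where e(x) = exp(πi x). -/

import Mathlib

open Complex

/-- The Riemann theta function with integer characteristic `(m', m'')`. -/
noncomputable def SiegelTheta (g : ℕ) (τ : Matrix (Fin g) (Fin g) ℂ)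
    (z : Fin g → ℂ) (m' m'' : Fin g → ℤ) : ℂ :=
  ∑' n : Fin g → ℤ,
    Complex.exp (Real.pi * Complex.I *
      ((∑ i, ∑ j, ((n i : ℂ) + (m' i : ℂ) / 2) * τ i j * ((n j : ℂ) + (m' j : ℂ) / 2)) +
        2 * ∑ i, ((n i : ℂ) + (m' i : ℂ) / 2) * (z i + (m'' i : ℂ) / 2)))

/-- `τ` belongs to the Siegel upper half space. -/
def InSiegelUpperHalfSpace {g : ℕ} (τ : Matrix (Fin g) (Fin g) ℂ) : Prop :=
  (∀ i j, τ i j = τ j i) ∧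
  (∀ x : Fin g → ℝ, x ≠ 0 → 0 < ∑ i, ∑ j, x i * (τ i j).im * x j)

/-- The `i`-th component of the gradient of `θ_m(τ, ·)` at `z = 0`. -/
noncomputable def thetaGrad (g : ℕ) (τ : Matrix (Fin g) (Fin g) ℂ)
    (m' m'' : Fin g → ℤ) (i : Fin g) : ℂ :=
  fderiv ℂ (fun z : Fin g → ℂ => SiegelTheta g τ z m' m'') 0 (Pi.single i 1)

/-- The Jacobian determinant `D[q_a, q_b, q_c]` of three theta gradients at
`z = 0`, for genus 3 and characteristics `c k = (m'_k, m''_k)`. -/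
noncomputable def thetaJacDet (τ : Matrix (Fin 3) (Fin 3) ℂ)
    (c : Fin 3 → (Fin 3 → ℤ) × (Fin 3 → ℤ)) : ℂ :=
  Matrix.det (Matrix.of fun k i => thetaGrad 3 τ (c k).1 (c k).2 i)

/-- The theta constant `θ(q_a + q_b + q_c)` with the non-reduced characteristic
given by the integer sum of the three characteristics. -/
noncomputable def tripleThetaConst (τ : Matrix (Fin 3) (Fin 3) ℂ)
    (m' m'' : Fin 7 → Fin 3 → ℤ) (a b c : Fin 7) : ℂ :=
  SiegelTheta 3 τ 0 (fun i => m' a i + m' b i + m' c i)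
    (fun i => m'' a i + m'' b i + m'' c i)

/-- `(m', m'')` is a (genus 3) Aronhold system of characteristics: seven
distinct odd characteristics with entries in `{0, 1}`, every three of which are
azygetic (the characteristic sum of any three of them is even). -/
def IsAronholdChar (m' m'' : Fin 7 → Fin 3 → ℤ) : Prop :=
  (∀ k i, m' k i = 0 ∨ m' k i = 1) ∧
  (∀ k i, m'' k i = 0 ∨ m'' k i = 1) ∧
  (∀ k, Odd (∑ i, m' k i * m'' k i)) ∧
  (∀ a b c : Fin 7, a ≠ b → a ≠ c → b ≠ c →
    Even (∑ i, (m' a i + m' b i + m' c i) * (m'' a i + m'' b i + m'' c i))) ∧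
  Function.Injective (fun k => (m' k, m'' k))

/-- Quadratic form attached to `τ`. -/
noncomputable def tquad (τ : Matrix (Fin 3) (Fin 3) ℂ) (N : Fin 3 → ℤ) : ℂ :=
  ∑ i, ∑ j, (N i : ℂ) * τ i j * (N j : ℂ)

/-- The exponential factor in a theta series, with doubled lattice variable. -/
noncomputable def texp (τ : Matrix (Fin 3) (Fin 3) ℂ) (z : Fin 3 → ℂ) (m'' : Fin 3 → ℤ)
    (N : Fin 3 → ℤ) : ℂ :=
  Complex.exp (Real.pi * Complex.I *
    (tquad τ N / 4 + ∑ i, (N i : ℂ) * z i + (∑ i, (N i : ℂ) * (m'' i : ℂ)) / 2))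

open Classical in
/-- The general term of a theta series, with doubled lattice variable. -/
noncomputable def tterm (τ : Matrix (Fin 3) (Fin 3) ℂ) (z : Fin 3 → ℂ) (m' m'' : Fin 3 → ℤ)
    (N : Fin 3 → ℤ) : ℂ :=
  if (∀ i, Even (N i - m' i)) then texp τ z m'' N else 0

lemma theta_eq_tsum (τ : Matrix (Fin 3) (Fin 3) ℂ) (z : Fin 3 → ℂ) (m' m'' : Fin 3 → ℤ) :
    SiegelTheta 3 τ z m' m'' = ∑' N, tterm τ z m' m'' N := by
  have hinj : Function.Injective (fun (n : Fin 3 → ℤ) (i : Fin 3) => 2 * n i + m' i) := by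
    intro a b h
    funext i
    have := congrFun h i
    simp only at this
    omega
  rw [← hinj.tsum_eq (f := tterm τ z m' m'')]
  · unfold SiegelTheta
    refine tsum_congr fun n => ?_
    have : ∀ i, Even (2 * n i + m' i - m' i) := fun i => ⟨n i, by ring⟩
    rw [tterm, if_pos this, texp, tquad]
    congr 2
    simp only [Fin.sum_univ_three]
    push_cast
    ring
  · intro N hN
    have h : ∀ i, Even (N i - m' i) := by
      by_contra h
      exact hN (by rw [tterm, if_neg h])
    choose k hk using h
    exact ⟨k, by funext i; have := hk i; simp only; omega⟩

lemma siegel_lower {τ : Matrix (Fin 3) (Fin 3) ℂ} (hτ : InSiegelUpperHalfSpace τ) :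
    ∃ l : ℝ, 0 < l ∧ ∀ x : Fin 3 → ℝ,
      l * ∑ i, x i ^ 2 ≤ ∑ i, ∑ j, x i * (τ i j).im * x j := by
  set f : (Fin 3 → ℝ) → ℝ := fun x => ∑ i, ∑ j, x i * (τ i j).im * x j with hf
  have hc : Continuous f := by fun_prop
  have hs : IsCompact (Metric.sphere (0 : Fin 3 → ℝ) 1) := isCompact_sphere _ _
  have hne : (Metric.sphere (0 : Fin 3 → ℝ) 1).Nonempty := ⟨fun _ => 1, by simp⟩
  obtain ⟨x0, hx0, hmin⟩ := hs.exists_isMinOn hne hc.continuousOn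
  have hx0' : x0 ≠ 0 := by
    rintro rfl
    simp at hx0
  have hpos := hτ.2 x0 hx0'
  refine ⟨f x0 / 3, by positivity, fun x => ?_⟩
  by_cases hx : x = 0
  · subst hx; simp
  have hn : 0 < ‖x‖ := norm_pos_iff.mpr hx
  have h1 : f x0 ≤ f (‖x‖⁻¹ • x) := hmin (by simp [norm_smul, hn.ne'])
  have h2 : f (‖x‖⁻¹ • x) = ‖x‖⁻¹ ^ 2 * f x := by
    simp only [hf, Fin.sum_univ_three, Pi.smul_apply, smul_eq_mul]
    ring
  rw [h2, inv_pow, inv_mul_eq_div, le_div_iff₀ (by positivity)] at h1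
  have h3 : ∀ i, x i ^ 2 ≤ ‖x‖ ^ 2 := fun i => by
    rw [← sq_abs]
    exact pow_le_pow_left₀ (abs_nonneg _) (norm_le_pi_norm x i) 2
  have h4 : ∑ i, x i ^ 2 ≤ 3 * ‖x‖ ^ 2 := by
    rw [Fin.sum_univ_three]; linarith [h3 0, h3 1, h3 2]
  calc f x0 / 3 * ∑ i, x i ^ 2 ≤ f x0 / 3 * (3 * ‖x‖ ^ 2) := by gcongr
    _ = f x0 * ‖x‖ ^ 2 := by ring
    _ ≤ _ := h1

/-- Majorant. -/
noncomputable def tmaj (T S : ℝ) (N : Fin 3 → ℤ) : ℝ :=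
  Real.exp (-Real.pi * (T * ∑ i, (N i : ℝ) ^ 2 - 2 * S * ∑ i, |(N i : ℝ)|))

lemma summable_tmaj {T : ℝ} (hT : 0 < T) (S : ℝ) : Summable (tmaj T S) := by
  have h1 := summable_pow_mul_jacobiTheta₂_term_bound S hT 0
  simp only [pow_zero, one_mul] at h1
  have h2 := h1.mul_of_nonneg (h1.mul_of_nonneg h1 (fun _ => (Real.exp_pos _).le)
    (fun _ => (Real.exp_pos _).le)) (fun _ => (Real.exp_pos _).le)
    (fun _ => mul_nonneg (Real.exp_pos _).le (Real.exp_pos _).le)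
  have hinj : Function.Injective (fun N : Fin 3 → ℤ => (N 0, N 1, N 2)) := by
    intro a b h
    simp only [Prod.mk.injEq] at h
    funext i
    fin_cases i
    · exact h.1
    · exact h.2.1
    · exact h.2.2
  refine (h2.comp_injective hinj).congr fun N => ?_
  simp only [tmaj, Function.comp, ← Real.exp_add, Fin.sum_univ_three]
  congr 1
  push_cast
  ring

lemma norm_texp_le {τ : Matrix (Fin 3) (Fin 3) ℂ} {l : ℝ}
    (hl : ∀ x : Fin 3 → ℝ, l * ∑ i, x i ^ 2 ≤ ∑ i, ∑ j, x i * (τ i j).im * x j)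
    (z : Fin 3 → ℂ) (B : ℝ) (hB : ‖z‖ ≤ B) (m'' N : Fin 3 → ℤ) :
    ‖texp τ z m'' N‖ ≤ tmaj (l / 4) (B / 2) N := by
  rw [texp, Complex.norm_exp, tmaj, Real.exp_le_exp]
  have h := hl (fun i => (N i : ℝ))
  have hz : ∀ i, -((N i : ℝ) * (z i).im) ≤ |(N i : ℝ)| * B := fun i => by
    calc -((N i : ℝ) * (z i).im) ≤ |(N i : ℝ) * (z i).im| := neg_le_abs _
      _ = |(N i : ℝ)| * |(z i).im| := abs_mul _ _
      _ ≤ |(N i : ℝ)| * B := by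
        gcongr
        exact (Complex.abs_im_le_norm _).trans ((norm_le_pi_norm z i).trans hB)
  have e : (Real.pi * Complex.I *
    (tquad τ N / 4 + ∑ i, (N i : ℂ) * z i + (∑ i, (N i : ℂ) * (m'' i : ℂ)) / 2)).re
    = -Real.pi * ((∑ i, ∑ j, (N i : ℝ) * (τ i j).im * (N j : ℝ)) / 4
        + ∑ i, (N i : ℝ) * (z i).im) := by
    have e1 : (tquad τ N / 4 + ∑ i, (N i : ℂ) * z i + (∑ i, (N i : ℂ) * (m'' i : ℂ)) / 2)
        = tquad τ N / (4 : ℝ) + ∑ i, (N i : ℂ) * z i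
          + ((∑ i, (N i : ℝ) * (m'' i : ℝ)) / 2 : ℝ) := by push_cast; rfl
    rw [mul_assoc, Complex.re_ofReal_mul, Complex.I_mul_re, e1, Complex.add_im, Complex.add_im,
      Complex.ofReal_im, Complex.div_ofReal_im, tquad]
    simp [Fin.sum_univ_three]
    ring
  rw [e]
  have h0 := hz 0
  have h1 := hz 1
  have h2 := hz 2
  rw [neg_mul, neg_mul, neg_le_neg_iff]
  refine mul_le_mul_of_nonneg_left ?_ Real.pi_pos.le
  simp only [Fin.sum_univ_three] at h ⊢
  linarith

lemma norm_tterm_le {τ : Matrix (Fin 3) (Fin 3) ℂ} {l : ℝ}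
    (hl : ∀ x : Fin 3 → ℝ, l * ∑ i, x i ^ 2 ≤ ∑ i, ∑ j, x i * (τ i j).im * x j)
    (z : Fin 3 → ℂ) (B : ℝ) (hB : ‖z‖ ≤ B) (m' m'' N : Fin 3 → ℤ) :
    ‖tterm τ z m' m'' N‖ ≤ tmaj (l / 4) (B / 2) N := by
  rw [tterm]
  split_ifs
  · exact norm_texp_le hl z B hB m'' N
  · rw [norm_zero]; exact (Real.exp_pos _).le

lemma summable_norm_tterm {τ : Matrix (Fin 3) (Fin 3) ℂ} (hτ : InSiegelUpperHalfSpace τ)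
    (z : Fin 3 → ℂ) (m' m'' : Fin 3 → ℤ) : Summable fun N => ‖tterm τ z m' m'' N‖ := by
  obtain ⟨l, hl0, hl⟩ := siegel_lower hτ
  exact Summable.of_nonneg_of_le (fun _ => norm_nonneg _)
    (fun N => norm_tterm_le hl z ‖z‖ le_rfl m' m'' N) (summable_tmaj (by positivity) _)

lemma differentiableAt_theta {τ : Matrix (Fin 3) (Fin 3) ℂ} (hτ : InSiegelUpperHalfSpace τ)
    (m' m'' : Fin 3 → ℤ) :
    DifferentiableAt ℂ (fun z : Fin 3 → ℂ => SiegelTheta 3 τ z m' m'') 0 := by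
  obtain ⟨l, hl0, hl⟩ := siegel_lower hτ
  simp only [theta_eq_tsum]
  let L : (Fin 3 → ℤ) → ((Fin 3 → ℂ) →L[ℂ] ℂ) := fun N =>
    ∑ i, (N i : ℂ) • ContinuousLinearMap.proj (R := ℂ) (φ := fun _ : Fin 3 => ℂ) i
  have hL : ∀ N, ‖L N‖ ≤ ∑ i, |(N i : ℝ)| := fun N => by
    refine (norm_sum_le _ _).trans (Finset.sum_le_sum fun i _ => ?_)
    rw [norm_smul]
    have : ‖(ContinuousLinearMap.proj (R := ℂ) (φ := fun _ : Fin 3 => ℂ) i)‖ ≤ 1 :=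
      ContinuousLinearMap.opNorm_le_bound _ zero_le_one
        (fun x => by simpa using norm_le_pi_norm x i)
    calc _ ≤ ‖(N i : ℂ)‖ * 1 := by gcongr
      _ = _ := by simp
  have hd : ∀ N x, HasFDerivAt (fun z => tterm τ z m' m'' N)
      ((tterm τ x m' m'' N * (Real.pi * Complex.I)) • L N) x := by
    intro N x
    by_cases h : ∀ i, Even (N i - m' i)
    · simp only [tterm, if_pos h, texp]
      have h1 : HasFDerivAt (fun z : Fin 3 → ℂ => ∑ i, (N i : ℂ) * z i) (L N) x := by
        have := (L N).hasFDerivAt (x := x)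
        refine this.congr_of_eventuallyEq (Filter.Eventually.of_forall fun z => ?_)
        simp [L]
      have h2 := (((h1.const_add (tquad τ N / 4)).add_const
        ((∑ i, (N i : ℂ) * (m'' i : ℂ)) / 2)).const_mul (Real.pi * Complex.I)).cexp
      refine h2.congr_fderiv ?_
      rw [smul_smul]
    · have h0 : (fun z => tterm τ z m' m'' N) = fun _ => 0 := by
        funext z
        rw [tterm, if_neg h]
      rw [h0, tterm, if_neg h, zero_mul]
      exact (hasFDerivAt_const (0 : ℂ) x).congr_fderiv (by ext; simp)
  refine (hasFDerivAt_tsum_of_isPreconnected (u := tmaj (l / 4) 1)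
    (summable_tmaj (by positivity) _) (Metric.isOpen_ball (x := (0 : Fin 3 → ℂ)) (ε := 1))
    (convex_ball _ _).isPreconnected (fun N x _ => hd N x) (fun N x hx => ?_)
    (Metric.mem_ball_self one_pos) (summable_norm_tterm hτ 0 m' m'').of_norm
    (Metric.mem_ball_self one_pos)).differentiableAt
  have hx' : ‖x‖ ≤ 1 := by simpa using (Metric.mem_ball.mp hx).le
  rw [norm_smul, norm_mul]
  have h1 := norm_tterm_le hl x 1 hx' m' m'' N
  have h2 : ‖(Real.pi * Complex.I : ℂ)‖ = Real.pi := by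
    simp [abs_of_pos Real.pi_pos]
  rw [h2]
  calc _ ≤ tmaj (l / 4) (1 / 2) N * Real.pi * ∑ i, |(N i : ℝ)| := by
        have := Real.pi_pos
        have h0 : 0 ≤ tmaj (l / 4) (1 / 2) N := (Real.exp_pos _).le
        gcongr
        exact hL N
    _ ≤ tmaj (l / 4) (1 / 2) N * Real.exp (Real.pi * ∑ i, |(N i : ℝ)|) := by
        rw [mul_assoc]
        gcongr
        · exact (Real.exp_pos _).le
        · linarith [Real.add_one_le_exp (Real.pi * ∑ i, |(N i : ℝ)|)]
    _ = tmaj (l / 4) 1 N := by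
        rw [tmaj, tmaj, ← Real.exp_add]
        congr 1
        ring

/-- `exp (π i k)` -/
noncomputable def esgn (k : ℤ) : ℂ := Complex.exp (Real.pi * Complex.I * (k : ℂ))

lemma esgn_add (a b : ℤ) : esgn (a + b) = esgn a * esgn b := by
  rw [esgn, esgn, esgn, ← Complex.exp_add]; push_cast; ring_nf

lemma esgn_even {k : ℤ} (h : Even k) : esgn k = 1 := by
  obtain ⟨r, rfl⟩ := h
  rw [esgn, Complex.exp_eq_one_iff]
  exact ⟨r, by push_cast; ring⟩

lemma esgn_odd {k : ℤ} (h : Odd k) : esgn k = -1 := by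
  obtain ⟨r, rfl⟩ := h
  rw [esgn_add, esgn_even ⟨r, by ring⟩, esgn, Int.cast_one, mul_one, Complex.exp_pi_mul_I, one_mul]

lemma theta_neg (τ : Matrix (Fin 3) (Fin 3) ℂ) (z : Fin 3 → ℂ) (m' m'' : Fin 3 → ℤ) :
    SiegelTheta 3 τ (-z) m' m'' = esgn (∑ i, m' i * m'' i) * SiegelTheta 3 τ z m' m'' := by
  rw [theta_eq_tsum, theta_eq_tsum, ← tsum_mul_left, ← (Equiv.neg (Fin 3 → ℤ)).tsum_eq]
  refine tsum_congr fun N => ?_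
  simp only [Equiv.neg_apply, tterm]
  by_cases h : ∀ i, Even (N i - m' i)
  · have h' : ∀ i, Even ((-N) i - m' i) := fun i => by
      have := h i
      simp only [Pi.neg_apply]
      rw [Int.even_iff] at this ⊢
      omega
    rw [if_pos h, if_pos h']
    choose k hk using h
    have hN : ∀ i, N i = m' i + 2 * k i := fun i => by have := hk i; omega
    have e1 : esgn (∑ i, m' i * m'' i) = esgn (-∑ i, N i * m'' i) := by
      have : (∑ i, m' i * m'' i) = (-∑ i, N i * m'' i)
          + (∑ i, (m' i + k i) * m'' i + ∑ i, (m' i + k i) * m'' i) := by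
        simp only [Fin.sum_univ_three, hN]; ring
      rw [this, esgn_add, esgn_even ⟨_, rfl⟩, mul_one]
    rw [e1, esgn, texp, texp, ← Complex.exp_add]
    congr 1
    simp only [tquad, Fin.sum_univ_three, Pi.neg_apply]
    push_cast
    ring
  · have h' : ¬ ∀ i, Even ((-N) i - m' i) := fun h' => h fun i => by
      have := h' i
      simp only [Pi.neg_apply] at this
      rw [Int.even_iff] at this ⊢
      omega
    rw [if_neg h, if_neg h', mul_zero]

lemma theta_odd_zero (τ : Matrix (Fin 3) (Fin 3) ℂ) {m' m'' : Fin 3 → ℤ}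
    (h : Odd (∑ i, m' i * m'' i)) : SiegelTheta 3 τ 0 m' m'' = 0 := by
  have := theta_neg τ 0 m' m''
  rw [neg_zero, esgn_odd h] at this
  have h2 : (2 : ℂ) * SiegelTheta 3 τ 0 m' m'' = 0 := by linear_combination this
  simpa using h2

lemma thetaGrad_even_zero {τ : Matrix (Fin 3) (Fin 3) ℂ} (hτ : InSiegelUpperHalfSpace τ)
    {m' m'' : Fin 3 → ℤ} (h : Even (∑ i, m' i * m'' i)) (i : Fin 3) :
    thetaGrad 3 τ m' m'' i = 0 := by
  have h1 : (fun z : Fin 3 → ℂ => SiegelTheta 3 τ (-z) m' m'')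
      = fun z => SiegelTheta 3 τ z m' m'' := by
    funext z
    rw [theta_neg, esgn_even h, one_mul]
  have hd := (differentiableAt_theta hτ m' m'').hasFDerivAt
  have hn : HasFDerivAt (fun z : Fin 3 → ℂ => -z)
      (-ContinuousLinearMap.id ℂ (Fin 3 → ℂ)) 0 := (hasFDerivAt_id _).neg
  rw [← neg_zero] at hd
  have h2 := (HasFDerivAt.comp (0 : Fin 3 → ℂ) hd hn).fderiv
  have h1' : ((fun z : Fin 3 → ℂ => SiegelTheta 3 τ z m' m'') ∘ fun z => -z)
      = fun z => SiegelTheta 3 τ z m' m'' := h1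
  rw [h1', neg_zero] at h2
  have h3 := congrArg (fun L => L (Pi.single i 1)) h2
  simp only [ContinuousLinearMap.comp_apply, neg_apply, map_neg,
    ContinuousLinearMap.id_apply] at h3
  rw [thetaGrad]
  exact self_eq_neg.mp h3

/-- Bits as integers. -/
def bitZ (c : Fin 3 → Fin 2) (i : Fin 3) : ℤ := ((c i : ℕ) : ℤ)

lemma sum_bits_esgn (x : Fin 3 → ℤ) :
    ∑ c : Fin 3 → Fin 2, esgn (∑ i, x i * bitZ c i) = ∏ i, (1 + esgn (x i)) := by
  have h : ∀ i, (1 + esgn (x i)) = ∑ j : Fin 2, esgn (x i * ((j : ℕ) : ℤ)) := by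
    intro i
    simp [Fin.sum_univ_two, esgn_even]
  simp only [h]
  rw [Finset.prod_univ_sum, Fintype.piFinset_univ]
  refine Finset.sum_congr rfl fun c _ => ?_
  simp only [Fin.sum_univ_three, Fin.prod_univ_three, esgn_add, bitZ]

lemma sum_bits_esgn_even {x : Fin 3 → ℤ} (h : ∀ i, Even (x i)) :
    ∑ c : Fin 3 → Fin 2, esgn (∑ i, x i * bitZ c i) = 8 := by
  rw [sum_bits_esgn]
  simp only [esgn_even (h _), Fin.prod_univ_three]
  norm_num

lemma sum_bits_esgn_odd {x : Fin 3 → ℤ} (h : ¬ ∀ i, Even (x i)) :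
    ∑ c : Fin 3 → Fin 2, esgn (∑ i, x i * bitZ c i) = 0 := by
  rw [sum_bits_esgn]
  push Not at h
  obtain ⟨i, hi⟩ := h
  refine Finset.prod_eq_zero (Finset.mem_univ i) ?_
  rw [esgn_odd (Int.not_even_iff_odd.mp hi)]
  norm_num

lemma key_exp (τ : Matrix (Fin 3) (Fin 3) ℂ) (z : Fin 3 → ℂ)
    (a'' b'' d'' e'' y c N1 N2 N3 N4 M1 M2 M3 M4 : Fin 3 → ℤ)
    (h1 : ∀ i, 2 * N1 i = M1 i + M2 i + M3 i + M4 i)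
    (h2 : ∀ i, 2 * N2 i = M1 i + M2 i - M3 i - M4 i)
    (h3 : ∀ i, 2 * N3 i = M1 i - M2 i + M3 i - M4 i)
    (h4 : ∀ i, 2 * N4 i = M1 i - M2 i - M3 i + M4 i) :
    esgn (∑ i, e'' i * N1 i + ∑ i, y i * c i) *
      (texp τ z c N1 * texp τ 0 (a'' + b'' + c) N2 *
        (texp τ 0 (a'' + d'' + c) N3 * texp τ 0 (b'' + d'' + c) N4)) =
    (texp τ ((1 / 2 : ℂ) • z) (a'' + b'' + d'' + e'') M1 * texp τ ((1 / 2 : ℂ) • z) (e'' - d'') M2 *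
      (texp τ ((1 / 2 : ℂ) • z) (e'' - b'') M3 * texp τ ((1 / 2 : ℂ) • z) (e'' - a'') M4)) *
      esgn (∑ i, (M1 i + y i) * c i) := by
  have g1 : ∀ i, (N1 i : ℂ) = ((M1 i : ℂ) + M2 i + M3 i + M4 i) / 2 := fun i => by
    rw [eq_div_iff two_ne_zero]; have := h1 i; rw [mul_comm]; exact_mod_cast this
  have g2 : ∀ i, (N2 i : ℂ) = ((M1 i : ℂ) + M2 i - M3 i - M4 i) / 2 := fun i => by
    rw [eq_div_iff two_ne_zero]; have := h2 i; rw [mul_comm]; exact_mod_cast this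
  have g3 : ∀ i, (N3 i : ℂ) = ((M1 i : ℂ) - M2 i + M3 i - M4 i) / 2 := fun i => by
    rw [eq_div_iff two_ne_zero]; have := h3 i; rw [mul_comm]; exact_mod_cast this
  have g4 : ∀ i, (N4 i : ℂ) = ((M1 i : ℂ) - M2 i - M3 i + M4 i) / 2 := fun i => by
    rw [eq_div_iff two_ne_zero]; have := h4 i; rw [mul_comm]; exact_mod_cast this
  have hq : tquad τ N1 + tquad τ N2 + tquad τ N3 + tquad τ N4
      = tquad τ M1 + tquad τ M2 + tquad τ M3 + tquad τ M4 := by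
    simp only [tquad, ← Finset.sum_add_distrib]
    refine Finset.sum_congr rfl fun i _ => Finset.sum_congr rfl fun j _ => ?_
    rw [g1, g2, g3, g4, g1, g2, g3, g4]
    ring
  simp only [texp, esgn, ← Complex.exp_add]
  congr 1
  simp only [Fin.sum_univ_three, Pi.add_apply, Pi.sub_apply, Pi.zero_apply, Pi.smul_apply,
    smul_eq_mul]
  push_cast
  simp only [g1, g2, g3, g4]
  linear_combination (Real.pi * Complex.I / 4) * hq

lemma key_sum (τ : Matrix (Fin 3) (Fin 3) ℂ) (z : Fin 3 → ℂ)
    (a' a'' b' b'' d' d'' e' e'' N1 N2 N3 N4 M1 M2 M3 M4 : Fin 3 → ℤ)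
    (h1 : ∀ i, 2 * N1 i = M1 i + M2 i + M3 i + M4 i)
    (h2 : ∀ i, 2 * N2 i = M1 i + M2 i - M3 i - M4 i)
    (h3 : ∀ i, 2 * N3 i = M1 i - M2 i + M3 i - M4 i)
    (h4 : ∀ i, 2 * N4 i = M1 i - M2 i - M3 i + M4 i) :
    ∑ c : (Fin 3 → Fin 2) × (Fin 3 → Fin 2),
      esgn (∑ i, e'' i * bitZ c.1 i + ∑ i, (e' i + (a' i + b' i + d' i)) * bitZ c.2 i) *
      (tterm τ z (bitZ c.1) (bitZ c.2) N1 *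
        tterm τ 0 (a' + b' + bitZ c.1) (a'' + b'' + bitZ c.2) N2 *
        (tterm τ 0 (a' + d' + bitZ c.1) (a'' + d'' + bitZ c.2) N3 *
         tterm τ 0 (b' + d' + bitZ c.1) (b'' + d'' + bitZ c.2) N4)) =
    8 * (tterm τ ((1 / 2 : ℂ) • z) (a' + b' + d' + e') (a'' + b'' + d'' + e'') M1 *
      tterm τ ((1 / 2 : ℂ) • z) (e' - d') (e'' - d'') M2 *
      (tterm τ ((1 / 2 : ℂ) • z) (e' - b') (e'' - b'') M3 *
       tterm τ ((1 / 2 : ℂ) • z) (e' - a') (e'' - a'') M4)) := by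
  by_cases hC : ∀ i, Even (N2 i - N1 i - a' i - b' i) ∧ Even (N3 i - N1 i - a' i - d' i) ∧
      Even (N4 i - N1 i - b' i - d' i)
  · let c0 : Fin 3 → Fin 2 := fun i => ⟨(N1 i % 2).toNat, by omega⟩
    have hc0 : ∀ i, bitZ c0 i = N1 i % 2 := fun i => by
      simp only [bitZ, c0]; omega
    rw [Fintype.sum_prod_type, Finset.sum_eq_single c0]
    · have hterm : ∀ c2 : Fin 3 → Fin 2,
        esgn (∑ i, e'' i * bitZ c0 i + ∑ i, (e' i + (a' i + b' i + d' i)) * bitZ c2 i) *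
        (tterm τ z (bitZ c0) (bitZ c2) N1 *
        tterm τ 0 (a' + b' + bitZ c0) (a'' + b'' + bitZ c2) N2 *
        (tterm τ 0 (a' + d' + bitZ c0) (a'' + d'' + bitZ c2) N3 *
         tterm τ 0 (b' + d' + bitZ c0) (b'' + d'' + bitZ c2) N4)) =
        (texp τ ((1 / 2 : ℂ) • z) (a'' + b'' + d'' + e'') M1 *
          texp τ ((1 / 2 : ℂ) • z) (e'' - d'') M2 *
        (texp τ ((1 / 2 : ℂ) • z) (e'' - b'') M3 * texp τ ((1 / 2 : ℂ) • z) (e'' - a'') M4)) *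
        esgn (∑ i, (M1 i + (e' i + (a' i + b' i + d' i))) * bitZ c2 i) := by
        intro c2
        rw [← key_exp τ z a'' b'' d'' e'' (fun i => e' i + (a' i + b' i + d' i)) (bitZ c2)
          N1 N2 N3 N4 M1 M2 M3 M4 h1 h2 h3 h4]
        have p1 : ∀ i, Even (N1 i - bitZ c0 i) := fun i => by
          rw [hc0, Int.even_iff]; omega
        have p2 : ∀ i, Even (N2 i - (a' + b' + bitZ c0) i) := fun i => by
          have := (hC i).1
          simp only [Pi.add_apply]
          rw [hc0, Int.even_iff] at *; omega
        have p3 : ∀ i, Even (N3 i - (a' + d' + bitZ c0) i) := fun i => by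
          have := (hC i).2.1
          simp only [Pi.add_apply]
          rw [hc0, Int.even_iff] at *; omega
        have p4 : ∀ i, Even (N4 i - (b' + d' + bitZ c0) i) := fun i => by
          have := (hC i).2.2
          simp only [Pi.add_apply]
          rw [hc0, Int.even_iff] at *; omega
        rw [tterm, tterm, tterm, tterm, if_pos p1, if_pos p2, if_pos p3, if_pos p4]
        congr 1
        rw [esgn_add, esgn_add]
        congr 1
        choose k hk using p1
        have : ∑ i, e'' i * N1 i = ∑ i, e'' i * bitZ c0 i + (∑ i, e'' i * k i + ∑ i, e'' i * k i) := by
          have hN : ∀ i, N1 i = bitZ c0 i + (k i + k i) := fun i => by have := hk i; omega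
          simp only [hN, Fin.sum_univ_three]; ring
        rw [this, esgn_add, esgn_even ⟨_, rfl⟩, mul_one]
      simp only [hterm]
      rw [← Finset.mul_sum]
      by_cases hx : ∀ i, Even (M1 i + (e' i + (a' i + b' i + d' i)))
      · rw [sum_bits_esgn_even hx]
        have p1 : ∀ i, Even (M1 i - (a' + b' + d' + e') i) := fun i => by
          have := hx i
          simp only [Pi.add_apply]
          rw [Int.even_iff] at *; omega
        have p2 : ∀ i, Even (M2 i - (e' - d') i) := fun i => by
          have := hx i
          have := (hC i).1
          have := h1 i
          have := h2 i
          simp only [Pi.sub_apply]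
          rw [Int.even_iff] at *; omega
        have p3 : ∀ i, Even (M3 i - (e' - b') i) := fun i => by
          have := hx i
          have := (hC i).2.1
          have := h1 i
          have := h3 i
          simp only [Pi.sub_apply]
          rw [Int.even_iff] at *; omega
        have p4 : ∀ i, Even (M4 i - (e' - a') i) := fun i => by
          have := hx i
          have := (hC i).2.2
          have := h1 i
          have := h4 i
          simp only [Pi.sub_apply]
          rw [Int.even_iff] at *; omega
        rw [tterm, tterm, tterm, tterm, if_pos p1, if_pos p2, if_pos p3, if_pos p4, mul_comm]
      · rw [sum_bits_esgn_odd hx]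
        have p1 : ¬ ∀ i, Even (M1 i - (a' + b' + d' + e') i) := fun h => hx fun i => by
          have := h i
          simp only [Pi.add_apply] at this
          rw [Int.even_iff] at *; omega
        rw [tterm, if_neg p1]
        ring
    · intro c1 _ hc1
      refine Finset.sum_eq_zero fun c2 _ => ?_
      have p1 : ¬ ∀ i, Even (N1 i - bitZ c1 i) := fun h => hc1 <| by
        funext i
        have := h i
        have h0 := hc0 i
        rw [Int.even_iff] at this
        have l1 := (c1 i).2
        simp only [bitZ] at this h0
        apply Fin.ext
        omega
      rw [tterm, if_neg p1]
      ring
    · intro h; exact absurd (Finset.mem_univ _) h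
  · rw [Finset.sum_eq_zero]
    · symm
      rw [mul_eq_zero]
      right
      by_contra hne
      apply hC
      have q1 : ∀ i, Even (M1 i - (a' + b' + d' + e') i) := by
        by_contra h; exact hne (by rw [tterm, if_neg h]; ring)
      have q2 : ∀ i, Even (M2 i - (e' - d') i) := by
        by_contra h
        exact hne (by rw [tterm.eq_def τ _ (e' - d'), if_neg h]; ring)
      have q3 : ∀ i, Even (M3 i - (e' - b') i) := by
        by_contra h
        exact hne (by rw [tterm.eq_def τ _ (e' - b') _ M3, if_neg h]; ring)
      have q4 : ∀ i, Even (M4 i - (e' - a') i) := by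
        by_contra h
        exact hne (by rw [tterm.eq_def τ _ (e' - a') _ M4, if_neg h]; ring)
      intro i
      have := q1 i
      have := q2 i
      have := q3 i
      have := q4 i
      have := h1 i
      have := h2 i
      have := h3 i
      have := h4 i
      simp only [Pi.add_apply, Pi.sub_apply, Int.even_iff] at *
      refine ⟨?_, ?_, ?_⟩ <;> omega
    · intro c _
      by_contra hne
      apply hC
      have q1 : ∀ i, Even (N1 i - bitZ c.1 i) := by
        by_contra h; exact hne (by rw [tterm, if_neg h]; ring)
      have q2 : ∀ i, Even (N2 i - (a' + b' + bitZ c.1) i) := by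
        by_contra h
        exact hne (by rw [tterm.eq_def τ _ _ _ N2, if_neg h]; ring)
      have q3 : ∀ i, Even (N3 i - (a' + d' + bitZ c.1) i) := by
        by_contra h
        exact hne (by rw [tterm.eq_def τ _ _ _ N3, if_neg h]; ring)
      have q4 : ∀ i, Even (N4 i - (b' + d' + bitZ c.1) i) := by
        by_contra h
        exact hne (by rw [tterm.eq_def τ _ _ _ N4, if_neg h]; ring)
      intro i
      have := q1 i
      have := q2 i
      have := q3 i
      have := q4 i
      simp only [Pi.add_apply, Int.even_iff] at *
      refine ⟨?_, ?_, ?_⟩ <;> omega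

/-- Quadruples of lattice vectors. -/
abbrev Quad := ((Fin 3 → ℤ) × (Fin 3 → ℤ)) × ((Fin 3 → ℤ) × (Fin 3 → ℤ))

/-- Quadruples with even sum. -/
def evenQuad : Set Quad := {N | ∀ i, Even (N.1.1 i + N.1.2 i + N.2.1 i + N.2.2 i)}

/-- The half-Hadamard transformation. -/
def hadamard (N : Quad) : Quad :=
  ((fun i => (N.1.1 i + N.1.2 i + N.2.1 i + N.2.2 i) / 2,
    fun i => (N.1.1 i + N.1.2 i - N.2.1 i - N.2.2 i) / 2),
   (fun i => (N.1.1 i - N.1.2 i + N.2.1 i - N.2.2 i) / 2,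
    fun i => (N.1.1 i - N.1.2 i - N.2.1 i + N.2.2 i) / 2))

lemma hadamard_mem {N : Quad} (h : N ∈ evenQuad) : hadamard N ∈ evenQuad := by
  intro i
  have := h i
  simp only [hadamard]
  rw [Int.even_iff] at *
  omega

lemma hadamard_invol {N : Quad} (h : N ∈ evenQuad) : hadamard (hadamard N) = N := by
  obtain ⟨⟨N1, N2⟩, ⟨N3, N4⟩⟩ := N
  simp only [hadamard, Prod.mk.injEq]
  refine ⟨⟨?_, ?_⟩, ⟨?_, ?_⟩⟩ <;>
  · funext i
    have := h i
    simp only [Int.even_iff] at this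
    omega

/-- The half-Hadamard transformation as a bijection. -/
def hadamardEquiv : evenQuad ≃ evenQuad where
  toFun N := ⟨hadamard N.1, hadamard_mem N.2⟩
  invFun N := ⟨hadamard N.1, hadamard_mem N.2⟩
  left_inv N := Subtype.ext (hadamard_invol N.2)
  right_inv N := Subtype.ext (hadamard_invol N.2)

lemma prod_theta {τ : Matrix (Fin 3) (Fin 3) ℂ} (hτ : InSiegelUpperHalfSpace τ)
    (z1 z2 z3 z4 : Fin 3 → ℂ) (m1 n1 m2 n2 m3 n3 m4 n4 : Fin 3 → ℤ) :
    HasSum (fun N : Quad => tterm τ z1 m1 n1 N.1.1 * tterm τ z2 m2 n2 N.1.2 *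
      (tterm τ z3 m3 n3 N.2.1 * tterm τ z4 m4 n4 N.2.2))
     (SiegelTheta 3 τ z1 m1 n1 * SiegelTheta 3 τ z2 m2 n2 *
      (SiegelTheta 3 τ z3 m3 n3 * SiegelTheta 3 τ z4 m4 n4)) := by
  simp only [theta_eq_tsum]
  have s1 := summable_norm_tterm hτ z1 m1 n1
  have s2 := summable_norm_tterm hτ z2 m2 n2
  have s3 := summable_norm_tterm hτ z3 m3 n3
  have s4 := summable_norm_tterm hτ z4 m4 n4
  have s12 := s1.mul_norm s2
  have s34 := s3.mul_norm s4
  rw [tsum_mul_tsum_of_summable_norm s1 s2, tsum_mul_tsum_of_summable_norm s3 s4,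
    tsum_mul_tsum_of_summable_norm s12 s34]
  exact (s12.mul_norm s34).of_norm.hasSum

lemma riemann {τ : Matrix (Fin 3) (Fin 3) ℂ} (hτ : InSiegelUpperHalfSpace τ) (z : Fin 3 → ℂ)
    (a' a'' b' b'' d' d'' e' e'' : Fin 3 → ℤ) :
    ∑ c : (Fin 3 → Fin 2) × (Fin 3 → Fin 2),
      esgn (∑ i, e'' i * bitZ c.1 i + ∑ i, (e' i + (a' i + b' i + d' i)) * bitZ c.2 i) *
      (SiegelTheta 3 τ z (bitZ c.1) (bitZ c.2) *
        SiegelTheta 3 τ 0 (a' + b' + bitZ c.1) (a'' + b'' + bitZ c.2) *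
        (SiegelTheta 3 τ 0 (a' + d' + bitZ c.1) (a'' + d'' + bitZ c.2) *
         SiegelTheta 3 τ 0 (b' + d' + bitZ c.1) (b'' + d'' + bitZ c.2))) =
    8 * (SiegelTheta 3 τ ((1 / 2 : ℂ) • z) (a' + b' + d' + e') (a'' + b'' + d'' + e'') *
      SiegelTheta 3 τ ((1 / 2 : ℂ) • z) (e' - d') (e'' - d'') *
      (SiegelTheta 3 τ ((1 / 2 : ℂ) • z) (e' - b') (e'' - b'') *
       SiegelTheta 3 τ ((1 / 2 : ℂ) • z) (e' - a') (e'' - a''))) := by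
  rw [← ((prod_theta hτ _ _ _ _ _ _ _ _ _ _ _ _).mul_left 8).tsum_eq]
  rw [← (hasSum_sum fun c _ => (prod_theta hτ _ _ _ _ _ _ _ _ _ _ _ _).mul_left
    (esgn (∑ i, e'' i * bitZ c.1 i + ∑ i, (e' i + (a' i + b' i + d' i)) * bitZ c.2 i))).tsum_eq]
  rw [← tsum_subtype_eq_of_support_subset (s := evenQuad),
    ← tsum_subtype_eq_of_support_subset (s := evenQuad), ← hadamardEquiv.tsum_eq]
  · refine tsum_congr fun M => ?_
    have hM := hadamard_invol M.2
    have hM2 := M.2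
    have hM1 := hadamard_mem M.2
    obtain ⟨⟨⟨M1, M2⟩, ⟨M3, M4⟩⟩, hM0⟩ := M
    refine key_sum τ z a' a'' b' b'' d' d'' e' e'' _ _ _ _ M1 M2 M3 M4 ?_ ?_ ?_ ?_ <;>
    · intro i
      have := hM2 i
      simp only [Int.even_iff] at this
      simp only [hadamardEquiv, hadamard, Equiv.coe_fn_mk]
      omega
  · intro M hM i
    rw [Function.mem_support] at hM
    have q1 : ∀ i, Even (M.1.1 i - (a' + b' + d' + e') i) := by
      by_contra h; exact hM (by rw [tterm, if_neg h]; ring)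
    have q2 : ∀ i, Even (M.1.2 i - (e' - d') i) := by
      by_contra h
      exact hM (by rw [tterm.eq_def τ _ (e' - d') _ M.1.2, if_neg h]; ring)
    have q3 : ∀ i, Even (M.2.1 i - (e' - b') i) := by
      by_contra h
      exact hM (by rw [tterm.eq_def τ _ (e' - b') _ M.2.1, if_neg h]; ring)
    have q4 : ∀ i, Even (M.2.2 i - (e' - a') i) := by
      by_contra h
      exact hM (by rw [tterm.eq_def τ _ (e' - a') _ M.2.2, if_neg h]; ring)
    have := q1 i
    have := q2 i
    have := q3 i
    have := q4 i
    simp only [Pi.add_apply, Pi.sub_apply, Int.even_iff] at *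
    omega
  · intro N hN
    rw [Function.mem_support] at hN
    obtain ⟨c, _, hM⟩ := Finset.exists_ne_zero_of_sum_ne_zero hN
    intro i
    have q1 : ∀ i, Even (N.1.1 i - bitZ c.1 i) := by
      by_contra h; exact hM (by rw [tterm, if_neg h]; ring)
    have q2 : ∀ i, Even (N.1.2 i - (a' + b' + bitZ c.1) i) := by
      by_contra h
      exact hM (by rw [tterm.eq_def τ _ _ _ N.1.2, if_neg h]; ring)
    have q3 : ∀ i, Even (N.2.1 i - (a' + d' + bitZ c.1) i) := by
      by_contra h
      exact hM (by rw [tterm.eq_def τ _ _ _ N.2.1, if_neg h]; ring)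
    have q4 : ∀ i, Even (N.2.2 i - (b' + d' + bitZ c.1) i) := by
      by_contra h
      exact hM (by rw [tterm.eq_def τ _ _ _ N.2.2, if_neg h]; ring)
    have := q1 i
    have := q2 i
    have := q3 i
    have := q4 i
    simp only [Pi.add_apply, Int.even_iff] at *
    omega

lemma grad_rel {τ : Matrix (Fin 3) (Fin 3) ℂ} (hτ : InSiegelUpperHalfSpace τ)
    (a' a'' b' b'' d' d'' e' e'' : Fin 3 → ℤ)
    (hd : Odd (∑ i, (e' - d') i * (e'' - d'') i)) (hb : Odd (∑ i, (e' - b') i * (e'' - b'') i))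
    (j : Fin 3) :
    ∑ c : (Fin 3 → Fin 2) × (Fin 3 → Fin 2),
      esgn (∑ i, e'' i * bitZ c.1 i + ∑ i, (e' i + (a' i + b' i + d' i)) * bitZ c.2 i) *
      (thetaGrad 3 τ (bitZ c.1) (bitZ c.2) j *
        SiegelTheta 3 τ 0 (a' + b' + bitZ c.1) (a'' + b'' + bitZ c.2) *
        (SiegelTheta 3 τ 0 (a' + d' + bitZ c.1) (a'' + d'' + bitZ c.2) *
         SiegelTheta 3 τ 0 (b' + d' + bitZ c.1) (b'' + d'' + bitZ c.2))) = 0 := by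
  have hL := HasFDerivAt.fun_sum (u := Finset.univ)
    fun (c : (Fin 3 → Fin 2) × (Fin 3 → Fin 2)) _ =>
    ((((differentiableAt_theta hτ (bitZ c.1) (bitZ c.2)).hasFDerivAt.mul_const
      (SiegelTheta 3 τ 0 (a' + b' + bitZ c.1) (a'' + b'' + bitZ c.2))).mul_const
      (SiegelTheta 3 τ 0 (a' + d' + bitZ c.1) (a'' + d'' + bitZ c.2) *
         SiegelTheta 3 τ 0 (b' + d' + bitZ c.1) (b'' + d'' + bitZ c.2))).const_mul
    (esgn (∑ i, e'' i * bitZ c.1 i + ∑ i, (e' i + (a' i + b' i + d' i)) * bitZ c.2 i)))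
  have hhalf : ∀ m n : Fin 3 → ℤ, ∃ L : (Fin 3 → ℂ) →L[ℂ] ℂ,
      HasFDerivAt (fun z : Fin 3 → ℂ => SiegelTheta 3 τ ((1 / 2 : ℂ) • z) m n) L 0 := by
    intro m n
    have h1 := (differentiableAt_theta hτ m n).hasFDerivAt
    rw [← smul_zero (1 / 2 : ℂ)] at h1
    exact ⟨_, HasFDerivAt.comp (0 : Fin 3 → ℂ) h1
      ((hasFDerivAt_id (0 : Fin 3 → ℂ)).const_smul (1 / 2 : ℂ))⟩
  obtain ⟨L1, h1⟩ := hhalf (a' + b' + d' + e') (a'' + b'' + d'' + e'')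
  obtain ⟨L2, h2⟩ := hhalf (e' - d') (e'' - d'')
  obtain ⟨L3, h3⟩ := hhalf (e' - b') (e'' - b'')
  obtain ⟨L4, h4⟩ := hhalf (e' - a') (e'' - a'')
  have hR := ((h1.mul h2).mul (h3.mul h4)).const_mul 8
  have heq := hL.unique (hR.congr_of_eventuallyEq
    (Filter.Eventually.of_forall fun z => riemann hτ z a' a'' b' b'' d' d'' e' e''))
  have := congrArg (fun L => L (Pi.single j 1)) heq
  simp only [smul_zero, Pi.mul_apply, theta_odd_zero τ hd, theta_odd_zero τ hb, mul_zero,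
    zero_mul] at this
  rw [sum_apply] at this
  refine Eq.trans ?_ (this.trans (by simp))
  refine Finset.sum_congr rfl fun c _ => ?_
  simp only [smul_apply, smul_eq_mul, thetaGrad]
  ring

/-- Characteristics modulo 2. -/
abbrev CharW := (Fin 3 → ZMod 2) × (Fin 3 → ZMod 2)

/-- The quadratic form on characteristics. -/
def cQ (u : CharW) : ZMod 2 := ∑ i, u.1 i * u.2 i

/-- The symplectic form on characteristics. -/
def cB (u v : CharW) : ZMod 2 := ∑ i, (u.1 i * v.2 i + u.2 i * v.1 i)

lemma cQ_add (u v : CharW) : cQ (u + v) = cQ u + cQ v + cB u v := by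
  simp only [cQ, cB, Fin.sum_univ_three, Prod.fst_add, Prod.snd_add, Pi.add_apply]; ring

lemma cB_add_left (u v w : CharW) : cB (u + v) w = cB u w + cB v w := by
  simp only [cB, Fin.sum_univ_three, Prod.fst_add, Prod.snd_add, Pi.add_apply]; ring

lemma cB_comm (u v : CharW) : cB u v = cB v u := by
  simp only [cB, Fin.sum_univ_three]; ring

lemma cB_add_right (u v w : CharW) : cB u (v + w) = cB u v + cB u w := by
  rw [cB_comm, cB_add_left, cB_comm v, cB_comm w]

lemma cB_smul_left (a : ZMod 2) (u w : CharW) : cB (a • u) w = a * cB u w := by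
  simp only [cB, Fin.sum_univ_three, Prod.smul_fst, Prod.smul_snd, Pi.smul_apply, smul_eq_mul]; ring

lemma cB_smul_right (a : ZMod 2) (u w : CharW) : cB u (a • w) = a * cB u w := by
  rw [cB_comm, cB_smul_left, cB_comm]

lemma cB_self (u : CharW) : cB u u = 0 := by
  have h : ∀ x y : ZMod 2, x * y + y * x = 0 := by decide
  simp only [cB, h, Finset.sum_const_zero]

lemma cQ_smul (a : ZMod 2) (u : CharW) : cQ (a • u) = a * cQ u := by
  have h : ∀ a x y : ZMod 2, a * x * (a * y) = a * (x * y) := by decide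
  simp only [cQ, Finset.mul_sum, Prod.smul_fst, Prod.smul_snd, Pi.smul_apply, smul_eq_mul, h]

lemma cQ_step (x v : CharW) (a s : ZMod 2) (h : cB x v = cQ v + s) :
    cQ (x + a • v) = cQ x + a * s := by
  rw [cQ_add, cQ_smul, cB_smul_right, h]
  clear h
  generalize cQ v = t
  generalize cQ x = q
  revert q t a s
  decide

/-- Affine combinations. -/
def comb (b : CharW) (v : Fin 6 → CharW) (a : Fin 6 → ZMod 2) : CharW :=
  b + a 0 • v 0 + a 1 • v 1 + a 2 • v 2 + a 3 • v 3 + a 4 • v 4 + a 5 • v 5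

lemma comb_pair {b : CharW} {v : Fin 6 → CharW}
    (hG : ∀ i j, cB (v i) (v j) = if i = j then 0 else 1)
    (hb : ∀ i, cB b (v i) = cQ (v i)) (a : Fin 6 → ZMod 2) (k : Fin 6) :
    cB (comb b v a) (v k) = cQ (v k) + (a 0 + a 1 + a 2 + a 3 + a 4 + a 5 + a k) := by
  have hs : ∀ x : ZMod 2, x + x = 0 := by decide
  simp only [comb, cB_add_left, cB_smul_left, hb, hG]
  generalize cQ (v k) = q
  have hk := hs (a k)
  fin_cases k <;> simp at hk ⊢ <;> linear_combination -hk

lemma comb_quad {b : CharW} {v : Fin 6 → CharW}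
    (hG : ∀ i j, cB (v i) (v j) = if i = j then 0 else 1)
    (hb : ∀ i, cB b (v i) = cQ (v i)) (hb1 : cQ b = 1) (a : Fin 6 → ZMod 2) :
    cQ (comb b v a) = 1 + a 0 * 0 + a 1 * a 0 + a 2 * (a 0 + a 1) + a 3 * (a 0 + a 1 + a 2)
      + a 4 * (a 0 + a 1 + a 2 + a 3) + a 5 * (a 0 + a 1 + a 2 + a 3 + a 4) := by
  rw [comb, cQ_step (s := a 0 + a 1 + a 2 + a 3 + a 4), cQ_step (s := a 0 + a 1 + a 2 + a 3),
    cQ_step (s := a 0 + a 1 + a 2), cQ_step (s := a 0 + a 1), cQ_step (s := a 0),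
    cQ_step (s := 0), hb1]
  all_goals
    simp only [cB_add_left, cB_smul_left, hb, hG]
    simp
  all_goals ring

lemma comb_inj {b : CharW} {v : Fin 6 → CharW}
    (hG : ∀ i j, cB (v i) (v j) = if i = j then 0 else 1)
    (hb : ∀ i, cB b (v i) = cQ (v i)) : Function.Injective (comb b v) := by
  intro x y hxy
  have h : ∀ k, (x 0 + x 1 + x 2 + x 3 + x 4 + x 5 + x k)
      = (y 0 + y 1 + y 2 + y 3 + y 4 + y 5 + y k) := fun k => by
    have h1 := comb_pair hG hb x k
    rw [hxy, comb_pair hG hb y k] at h1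
    exact (add_left_cancel h1).symm
  have hs : ∀ x : ZMod 2, x + x = 0 := by decide
  have hsum : x 0 + x 1 + x 2 + x 3 + x 4 + x 5 = y 0 + y 1 + y 2 + y 3 + y 4 + y 5 := by
    linear_combination h 0 + h 1 + h 2 + h 3 + h 4 + h 5
      - 3 * hs (x 0 + x 1 + x 2 + x 3 + x 4 + x 5) + 3 * hs (y 0 + y 1 + y 2 + y 3 + y 4 + y 5)
  funext k
  linear_combination h k - hsum

lemma comb_surj {b : CharW} {v : Fin 6 → CharW}
    (hG : ∀ i j, cB (v i) (v j) = if i = j then 0 else 1)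
    (hb : ∀ i, cB b (v i) = cQ (v i)) (c : CharW) : ∃ a, comb b v a = c := by
  have : Function.Bijective (comb b v) := by
    rw [Fintype.bijective_iff_injective_and_card]
    exact ⟨comb_inj hG hb, by simp⟩
  exact this.2 c

section
variable {w : Fin 7 → CharW}

lemma gram (hQ : ∀ k, cQ (w k) = 1)
    (hT : ∀ a b c : Fin 7, a ≠ b → a ≠ c → b ≠ c → cQ (w a + w b + w c) = 0)
    (i j : Fin 6) :
    cB (w i.castSucc + w 6) (w j.castSucc + w 6) = if i = j then 0 else 1 := by
  by_cases hij : i = j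
  · rw [if_pos hij, hij, cB_self]
  rw [if_neg hij]
  have h := hT i.castSucc j.castSucc 6 (fun h => hij (Fin.castSucc_injective _ h))
    (Fin.castSucc_lt_last i).ne (Fin.castSucc_lt_last j).ne
  simp only [cQ_add, cB_add_left, cB_add_right, cB_self, hQ, cB_comm (w 6) (w j.castSucc)] at *
  generalize cB (w i.castSucc) (w j.castSucc) = x at *
  generalize cB (w i.castSucc) (w 6) = y at *
  generalize cB (w j.castSucc) (w 6) = z at *
  clear hQ hT hij
  revert x y z
  decide

lemma base_pair (hQ : ∀ k, cQ (w k) = 1) (i : Fin 6) :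
    cB (w 6) (w i.castSucc + w 6) = cQ (w i.castSucc + w 6) := by
  simp only [cQ_add, cB_add_right, cB_self, hQ, cB_comm (w 6) (w i.castSucc)]
  generalize cB (w i.castSucc) (w 6) = x at *
  revert x
  decide

lemma cancel_six (x y : CharW) : y + (x + y) = x := by
  have : ∀ a b : ZMod 2, b + (a + b) = a := by decide
  ext i
  · exact this _ _
  · exact this _ _

lemma cB_four (hQ : ∀ k, cQ (w k) = 1)
    (hT : ∀ a b c : Fin 7, a ≠ b → a ≠ c → b ≠ c → cQ (w a + w b + w c) = 0)
    (a : Fin 6 → ZMod 2) :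
    cB (w 0 + w 1 + w 2 + w 3) (comb (w 6) (fun k => w k.castSucc + w 6) a + w 0)
      = a 0 + a 1 + a 2 + a 3 + 1 := by
  set v : Fin 6 → CharW := fun k => w k.castSucc + w 6 with hv
  have hG : ∀ i j, cB (v i) (v j) = if i = j then 0 else 1 := gram hQ hT
  have hb : ∀ i, cB (w 6) (v i) = cQ (v i) := base_pair hQ
  have hs : ∀ x : ZMod 2, x + x = 0 := by decide
  have e1 : w 0 + w 1 + w 2 + w 3 = v 0 + v 1 + v 2 + v 3 := by
    have : ∀ a b c d e : ZMod 2, a + b + c + d = (a + e) + (b + e) + (c + e) + (d + e) := by decide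
    ext i
    · exact this _ _ _ _ _
    · exact this _ _ _ _ _
  have e2 : w 0 = w 6 + v 0 := (cancel_six _ _).symm
  rw [e1, cB_comm, e2]
  have p := comb_pair hG hb a
  simp only [cB_add_left, cB_add_right, p, hb, hG]
  simp
  generalize cQ (v 0) = x0
  generalize cQ (v 1) = x1
  generalize cQ (v 2) = x2
  generalize cQ (v 3) = x3
  linear_combination hs x0 + hs x1 + hs x2 + hs x3 + 2 * hs (a 0 + a 1 + a 2 + a 3 + a 4 + a 5)
    + hs 1

lemma char_class (hQ : ∀ k, cQ (w k) = 1)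
    (hT : ∀ a b c : Fin 7, a ≠ b → a ≠ c → b ≠ c → cQ (w a + w b + w c) = 0)
    (c : CharW) (h0 : cQ c = 1) (h1 : cQ (w 4 + w 5 + c) = 0) (h2 : cQ (w 4 + w 6 + c) = 0)
    (h3 : cQ (w 5 + w 6 + c) = 0) (h4 : cB (w 0 + w 1 + w 2 + w 3) (c + w 0) = 0) :
    c = w 0 ∨ c = w 1 ∨ c = w 2 ∨ c = w 3 := by
  set v : Fin 6 → CharW := fun k => w k.castSucc + w 6 with hv
  have hG : ∀ i j, cB (v i) (v j) = if i = j then 0 else 1 := gram hQ hT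
  have hb : ∀ i, cB (w 6) (v i) = cQ (v i) := base_pair hQ
  obtain ⟨a, rfl⟩ := comb_surj hG hb c
  have hs : ∀ x : ZMod 2, x + x = 0 := by decide
  rw [cB_four hQ hT] at h4
  have p4 := comb_pair hG hb a 4
  have p5 := comb_pair hG hb a 5
  have e4 : w 4 + w 6 = v 4 := rfl
  have e5 : w 5 + w 6 = v 5 := rfl
  have e45 : w 4 + w 5 = v 4 + v 5 := by
    have : ∀ a b e : ZMod 2, a + b = (a + e) + (b + e) := by decide
    ext i
    · exact this _ _ _
    · exact this _ _ _
  rw [e45, add_comm, cQ_add, cQ_add, cB_add_right (comb _ _ _), p4, p5, h0, hG,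
    if_neg (by decide)] at h1
  rw [e4, add_comm, cQ_add, p4, h0] at h2
  rw [e5, add_comm, cQ_add, p5, h0] at h3
  rw [comb_quad hG hb (hQ 6)] at h0
  have g5 : a 5 = 0 := by
    linear_combination h2 - h4 - hs (cQ (v 4)) - hs (a 4)
  have g4 : a 4 = 0 := by
    linear_combination h3 - h4 - hs (cQ (v 5)) - hs (a 5)
  rw [g4, g5] at h0
  have fin : ∀ x0 x1 x2 x3 : ZMod 2,
      1 + x0 * 0 + x1 * x0 + x2 * (x0 + x1) + x3 * (x0 + x1 + x2)
        + 0 * (x0 + x1 + x2 + x3) + 0 * (x0 + x1 + x2 + x3 + 0) = 1 →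
      x0 + x1 + x2 + x3 + 1 = 0 →
      (x0 = 1 ∧ x1 = 0 ∧ x2 = 0 ∧ x3 = 0) ∨
      (x0 = 0 ∧ x1 = 1 ∧ x2 = 0 ∧ x3 = 0) ∨
      (x0 = 0 ∧ x1 = 0 ∧ x2 = 1 ∧ x3 = 0) ∨
      (x0 = 0 ∧ x1 = 0 ∧ x2 = 0 ∧ x3 = 1) := by decide
  have := fin _ _ _ _ h0 h4
  rcases this with h | h | h | h <;> obtain ⟨g0, g1, g2, g3⟩ := h <;>
    simp only [comb, g0, g1, g2, g3, g4, g5, zero_smul, one_smul, add_zero]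
  · exact Or.inl (cancel_six _ _)
  · exact Or.inr (Or.inl (cancel_six _ _))
  · exact Or.inr (Or.inr (Or.inl (cancel_six _ _)))
  · exact Or.inr (Or.inr (Or.inr (cancel_six _ _)))

lemma cB_four_mem (hQ : ∀ k, cQ (w k) = 1)
    (hT : ∀ a b c : Fin 7, a ≠ b → a ≠ c → b ≠ c → cQ (w a + w b + w c) = 0)
    (k : Fin 7) (hk : k = 0 ∨ k = 1 ∨ k = 2 ∨ k = 3) :
    cB (w 0 + w 1 + w 2 + w 3) (w k + w 0) = 0 := by
  have key : ∀ j : Fin 6, comb (w 6) (fun k => w k.castSucc + w 6) (Pi.single j 1)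
      = w j.castSucc := by
    intro j
    rw [← cancel_six (w j.castSucc) (w 6)]
    fin_cases j <;> simp [comb]
  rcases hk with rfl | rfl | rfl | rfl
  · have := cB_four hQ hT (Pi.single 0 1)
    rw [key] at this
    exact this.trans (by decide)
  · have := cB_four hQ hT (Pi.single 1 1)
    rw [key] at this
    exact this.trans (by decide)
  · have := cB_four hQ hT (Pi.single 2 1)
    rw [key] at this
    exact this.trans (by decide)
  · have := cB_four hQ hT (Pi.single 3 1)
    rw [key] at this
    exact this.trans (by decide)

/-- The sum `q₁+q₂+q₃+q₄+q_k` is odd for `k = 6, 7`. -/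
lemma cQ_five (hQ : ∀ k, cQ (w k) = 1)
    (hT : ∀ a b c : Fin 7, a ≠ b → a ≠ c → b ≠ c → cQ (w a + w b + w c) = 0)
    (k : Fin 7) (hk : k = 5 ∨ k = 6) :
    cQ (w 0 + w 1 + w 2 + w 3 + w k) = 1 := by
  have hp : ∀ i j l : Fin 7, i ≠ j → i ≠ l → j ≠ l →
      1 + 1 + cB (w i) (w j) + 1 + (cB (w i) (w l) + cB (w j) (w l)) = 0 := by
    intro i j l h1 h2 h3
    have := hT i j l h1 h2 h3
    rwa [cQ_add, cQ_add, cB_add_left, hQ, hQ, hQ] at this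
  have h0 := hp 0 1 k (by decide) (by omega) (by omega)
  have h1 := hp 2 3 k (by decide) (by omega) (by omega)
  have h2 := hp 0 1 2 (by decide) (by decide) (by decide)
  have h3 := hp 0 1 3 (by decide) (by decide) (by decide)
  simp only [cQ_add, cB_add_left, hQ]
  have hs : ∀ x : ZMod 2, x + x = 0 := by decide
  linear_combination h0 + h1 + h2 + h3 - hs (cB (w 0) (w 1)) - hs 1 - hs 1 - hs 1 - hs 1
end

lemma even_iff_cast (k : ℤ) : Even k ↔ (k : ZMod 2) = 0 := by
  rw [even_iff_two_dvd]
  exact (ZMod.intCast_zmod_eq_zero_iff_dvd k 2).symm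

lemma odd_iff_cast (k : ℤ) : Odd k ↔ (k : ZMod 2) = 1 := by
  rw [← Int.not_even_iff_odd, even_iff_cast]
  generalize (k : ZMod 2) = x
  revert x
  decide

/-- Reduction of a characteristic modulo 2. -/
def redW (x y : Fin 3 → ℤ) : CharW := (fun i => (x i : ZMod 2), fun i => (y i : ZMod 2))

lemma cast_quad (x y : Fin 3 → ℤ) : ((∑ i, x i * y i : ℤ) : ZMod 2) = cQ (redW x y) := by
  simp [cQ, redW]

lemma redW_add (x y u v : Fin 3 → ℤ) : redW (x + u) (y + v) = redW x y + redW u v := by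
  ext i <;> simp [redW]

lemma redW_sub (x y u v : Fin 3 → ℤ) : redW (x - u) (y - v) = redW x y + redW u v := by
  have h : ∀ a b : ZMod 2, a - b = a + b := by decide
  ext i <;> simp [redW, h]

lemma grad_rel4 {τ : Matrix (Fin 3) (Fin 3) ℂ} (hτ : InSiegelUpperHalfSpace τ)
    {m' m'' : Fin 7 → Fin 3 → ℤ} (hA : IsAronholdChar m' m'') (j : Fin 3) :
    ∑ k : Fin 4, esgn (∑ i, (m' 4 i + m' 5 i + m' 6 i) * m'' (k.castLE (by omega)) i) *
      (thetaGrad 3 τ (m' (k.castLE (by omega))) (m'' (k.castLE (by omega))) j *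
        tripleThetaConst τ m' m'' 4 5 (k.castLE (by omega)) *
        (tripleThetaConst τ m' m'' 4 6 (k.castLE (by omega)) *
          tripleThetaConst τ m' m'' 5 6 (k.castLE (by omega)))) = 0 := by
  obtain ⟨hb1, hb2, hodd, heven, hinj⟩ := hA
  set w : Fin 7 → CharW := fun k => redW (m' k) (m'' k) with hw
  have hQ : ∀ k, cQ (w k) = 1 := fun k => by
    rw [hw, ← cast_quad, ← odd_iff_cast]; exact hodd k
  have hT : ∀ a b c : Fin 7, a ≠ b → a ≠ c → b ≠ c → cQ (w a + w b + w c) = 0 := by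
    intro a b c h1 h2 h3
    simp only [hw]
    rw [← redW_add, ← redW_add, ← cast_quad, ← even_iff_cast]
    exact heven a b c h1 h2 h3
  have hpar : ∀ x y : Fin 3 → ℤ, Odd (∑ i, x i * y i) ↔ cQ (redW x y) = 1 := fun x y => by
    rw [odd_iff_cast, cast_quad]
  have hparE : ∀ x y : Fin 3 → ℤ, Even (∑ i, x i * y i) ↔ cQ (redW x y) = 0 := fun x y => by
    rw [even_iff_cast, cast_quad]
  have hz : redW 0 0 = 0 := by ext i <;> simp [redW]
  set e' : Fin 3 → ℤ := m' 0 + m' 1 + m' 2 + m' 3 with he'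
  set e'' : Fin 3 → ℤ := m'' 0 + m'' 1 + m'' 2 + m'' 3 with he''
  have hew : redW e' e'' = w 0 + w 1 + w 2 + w 3 := by
    rw [he', he'', redW_add, redW_add, redW_add]
  -- the two Riemann relations
  have R0 := grad_rel hτ (m' 4) (m'' 4) (m' 5) (m'' 5) (m' 6) (m'' 6) 0 0
    (by rw [hpar, redW_sub, hz, zero_add]; exact hQ 6)
    (by rw [hpar, redW_sub, hz, zero_add]; exact hQ 5) j
  have R1 := grad_rel hτ (m' 4) (m'' 4) (m' 5) (m'' 5) (m' 6) (m'' 6) e' e''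
    (by rw [hpar, redW_sub, hew]; exact cQ_five hQ hT 6 (Or.inr rfl))
    (by rw [hpar, redW_sub, hew]; exact cQ_five hQ hT 5 (Or.inl rfl)) j
  -- the general term
  set t : (Fin 3 → Fin 2) × (Fin 3 → Fin 2) → ℂ := fun c =>
    esgn (∑ i, (m' 4 i + m' 5 i + m' 6 i) * bitZ c.2 i) *
      (thetaGrad 3 τ (bitZ c.1) (bitZ c.2) j *
        SiegelTheta 3 τ 0 (m' 4 + m' 5 + bitZ c.1) (m'' 4 + m'' 5 + bitZ c.2) *
        (SiegelTheta 3 τ 0 (m' 4 + m' 6 + bitZ c.1) (m'' 4 + m'' 6 + bitZ c.2) *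
         SiegelTheta 3 τ 0 (m' 5 + m' 6 + bitZ c.1) (m'' 5 + m'' 6 + bitZ c.2))) with ht
  set p : (Fin 3 → Fin 2) × (Fin 3 → Fin 2) → ℤ := fun c =>
    ∑ i, (e' i * bitZ c.2 i + e'' i * bitZ c.1 i) with hp
  set p0 : ℤ := ∑ i, (e' i * m'' 0 i + e'' i * m' 0 i) with hp0
  have hpc : ∀ c, ((p c + p0 : ℤ) : ZMod 2)
      = cB (w 0 + w 1 + w 2 + w 3) (redW (bitZ c.1) (bitZ c.2) + w 0) := by
    intro c
    rw [← hew]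
    simp only [hp, hp0, hw, cB, redW, Fin.sum_univ_three, Prod.fst_add, Prod.snd_add, Pi.add_apply]
    push_cast
    ring
  have S : ∑ c, (1 + esgn (p c + p0)) * t c = 0 := by
    have s0 : ∑ c, t c = 0 := by
      rw [← R0]
      refine Finset.sum_congr rfl fun c _ => ?_
      simp [ht]
    have s1 : ∑ c, esgn (p c) * t c = 0 := by
      rw [← R1]
      refine Finset.sum_congr rfl fun c _ => ?_
      simp only [ht]
      rw [← mul_assoc, ← esgn_add]
      congr 2
      simp only [hp, Fin.sum_univ_three]
      ring
    calc ∑ c, (1 + esgn (p c + p0)) * t c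
        = ∑ c, t c + esgn p0 * ∑ c, esgn (p c) * t c := by
          rw [Finset.mul_sum, ← Finset.sum_add_distrib]
          refine Finset.sum_congr rfl fun c _ => ?_
          rw [esgn_add]; ring
      _ = 0 := by rw [s0, s1]; ring
  -- bits of the characteristics
  have hbit : ∀ x : Fin 3 → ℤ, (∀ i, x i = 0 ∨ x i = 1) → ∃ c : Fin 3 → Fin 2, bitZ c = x := by
    intro x hx
    refine ⟨fun i => ⟨(x i).toNat, ?_⟩, ?_⟩
    · have := hx i; omega
    · funext i
      have := hx i
      simp only [bitZ]; omega
  choose f1 hf1 using fun k => hbit (m' k) (hb1 k)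
  choose f2 hf2 using fun k => hbit (m'' k) (hb2 k)
  have hlt : 4 ≤ 7 := by omega
  let κ : Fin 4 → (Fin 3 → Fin 2) × (Fin 3 → Fin 2) := fun k =>
    (f1 (k.castLE hlt), f2 (k.castLE hlt))
  have hκ : Function.Injective κ := by
    intro k l h
    have h1 : f1 (k.castLE hlt) = f1 (l.castLE hlt) := congrArg Prod.fst h
    have h2 : f2 (k.castLE hlt) = f2 (l.castLE hlt) := congrArg Prod.snd h
    refine Fin.castLE_injective hlt (hinj ?_)
    simp only [Prod.mk.injEq]
    exact ⟨by rw [← hf1, ← hf1, h1], by rw [← hf2, ← hf2, h2]⟩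
  have hbit_inj : ∀ (c : Fin 3 → Fin 2) (x : Fin 3 → ℤ), (∀ i, x i = 0 ∨ x i = 1) →
      (∀ i, ((bitZ c i : ℤ) : ZMod 2) = (x i : ZMod 2)) → bitZ c = x := by
    intro c x hx h
    funext i
    have h1 := h i
    rw [← sub_eq_zero, ← Int.cast_sub, ← even_iff_cast, Int.even_iff] at h1
    have h2 := hx i
    have h3 := (c i).2
    simp only [bitZ] at h1 ⊢
    omega
  have hbitZ_inj : Function.Injective bitZ := by
    intro c d h
    funext i
    have := congrFun h i
    simp only [bitZ] at this
    exact Fin.ext (by exact_mod_cast this)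
  have hsum : ∑ k, 2 * t (κ k) = ∑ c, (1 + esgn (p c + p0)) * t c := by
    refine Fintype.sum_of_injective κ hκ _ _ ?_ ?_
    · intro c hc
      by_contra hne
      apply hc
      have hn1 : esgn (p c + p0) ≠ -1 := fun h => hne (by rw [h]; ring)
      have ht0 : t c ≠ 0 := fun h => hne (by rw [h]; ring)
      have c4 : cB (w 0 + w 1 + w 2 + w 3) (redW (bitZ c.1) (bitZ c.2) + w 0) = 0 := by
        rw [← hpc, ← even_iff_cast]
        by_contra h
        exact hn1 (esgn_odd (Int.not_even_iff_odd.mp h))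
      have c0 : cQ (redW (bitZ c.1) (bitZ c.2)) = 1 := by
        rw [← hpar]
        by_contra h
        refine ht0 ?_
        simp only [ht]
        rw [thetaGrad_even_zero hτ (Int.not_odd_iff_even.mp h)]
        ring
      have c1 : cQ (w 4 + w 5 + redW (bitZ c.1) (bitZ c.2)) = 0 := by
        simp only [hw]
        rw [← redW_add, ← redW_add, ← hparE]
        by_contra h
        refine ht0 ?_
        simp only [ht]
        rw [theta_odd_zero τ (Int.not_even_iff_odd.mp h)]
        ring
      have c2 : cQ (w 4 + w 6 + redW (bitZ c.1) (bitZ c.2)) = 0 := by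
        simp only [hw]
        rw [← redW_add, ← redW_add, ← hparE]
        by_contra h
        refine ht0 ?_
        simp only [ht]
        rw [theta_odd_zero τ (Int.not_even_iff_odd.mp h)]
        ring
      have c3 : cQ (w 5 + w 6 + redW (bitZ c.1) (bitZ c.2)) = 0 := by
        simp only [hw]
        rw [← redW_add, ← redW_add, ← hparE]
        by_contra h
        refine ht0 ?_
        simp only [ht]
        rw [theta_odd_zero τ (Int.not_even_iff_odd.mp h)]
        ring
      have fin : ∀ k : Fin 4, redW (bitZ c.1) (bitZ c.2) = w (k.castLE hlt) → κ k = c := by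
        intro k h
        have g1 : bitZ c.1 = m' (k.castLE hlt) :=
          hbit_inj _ _ (hb1 _) fun i => congrFun (congrArg Prod.fst h) i
        have g2 : bitZ c.2 = m'' (k.castLE hlt) :=
          hbit_inj _ _ (hb2 _) fun i => congrFun (congrArg Prod.snd h) i
        refine Prod.ext (hbitZ_inj ?_) (hbitZ_inj ?_)
        · rw [g1]; exact hf1 _
        · rw [g2]; exact hf2 _
      rcases char_class hQ hT _ c0 c1 c2 c3 c4 with h | h | h | h
      · exact ⟨0, fin 0 h⟩
      · exact ⟨1, fin 1 h⟩
      · exact ⟨2, fin 2 h⟩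
      · exact ⟨3, fin 3 h⟩
    · intro k
      have hev : Even (p (κ k) + p0) := by
        rw [even_iff_cast, hpc]
        simp only [κ, hf1, hf2]
        refine cB_four_mem hQ hT (k.castLE hlt) ?_
        fin_cases k <;> simp
      rw [esgn_even hev]
      ring
  rw [S, ← Finset.mul_sum] at hsum
  have hfin := (mul_eq_zero.mp hsum).resolve_left two_ne_zero
  rw [← hfin]
  refine Finset.sum_congr rfl fun k _ => ?_
  simp only [ht, κ, hf1, hf2]
  rfl

/-- Proposition 4 (ratio of Jacobian determinants): for an azygetic 4-tuple
`q₁, q₂, q₃, q₄` completed by `q₅, q₆, q₇` to an Aronhold system (indices `0`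
through `6` below),
`D[q₄,q₂,q₃]/D[q₁,q₂,q₃] = −e((q₅+q₆+q₇)'·(q₁+q₄)'') ·
θ(q₅+q₆+q₁)θ(q₅+q₇+q₁)θ(q₆+q₇+q₁) / (θ(q₅+q₆+q₄)θ(q₅+q₇+q₄)θ(q₆+q₇+q₄))`. -/
theorem jacobian_determinant_ratio (τ : Matrix (Fin 3) (Fin 3) ℂ)
    (hτ : InSiegelUpperHalfSpace τ)
    (m' m'' : Fin 7 → Fin 3 → ℤ)
    (hA : IsAronholdChar m' m'')
    (hD : thetaJacDet τ ![(m' 0, m'' 0), (m' 1, m'' 1), (m' 2, m'' 2)] ≠ 0)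
    (hθ₁ : tripleThetaConst τ m' m'' 4 5 3 ≠ 0)
    (hθ₂ : tripleThetaConst τ m' m'' 4 6 3 ≠ 0)
    (hθ₃ : tripleThetaConst τ m' m'' 5 6 3 ≠ 0) :
    thetaJacDet τ ![(m' 3, m'' 3), (m' 1, m'' 1), (m' 2, m'' 2)] /
        thetaJacDet τ ![(m' 0, m'' 0), (m' 1, m'' 1), (m' 2, m'' 2)] =
      -Complex.exp (Real.pi * Complex.I *
          ((∑ i, (m' 4 i + m' 5 i + m' 6 i) * (m'' 0 i + m'' 3 i) : ℤ) : ℂ)) *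
        (tripleThetaConst τ m' m'' 4 5 0 * tripleThetaConst τ m' m'' 4 6 0 *
          tripleThetaConst τ m' m'' 5 6 0) /
        (tripleThetaConst τ m' m'' 4 5 3 * tripleThetaConst τ m' m'' 4 6 3 *
          tripleThetaConst τ m' m'' 5 6 3) := by
  have hrel : ∀ j, esgn (∑ i, (m' 4 i + m' 5 i + m' 6 i) * m'' 0 i) *
      (thetaGrad 3 τ (m' 0) (m'' 0) j * tripleThetaConst τ m' m'' 4 5 0 *
        (tripleThetaConst τ m' m'' 4 6 0 * tripleThetaConst τ m' m'' 5 6 0)) +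
      esgn (∑ i, (m' 4 i + m' 5 i + m' 6 i) * m'' 1 i) *
      (thetaGrad 3 τ (m' 1) (m'' 1) j * tripleThetaConst τ m' m'' 4 5 1 *
        (tripleThetaConst τ m' m'' 4 6 1 * tripleThetaConst τ m' m'' 5 6 1)) +
      esgn (∑ i, (m' 4 i + m' 5 i + m' 6 i) * m'' 2 i) *
      (thetaGrad 3 τ (m' 2) (m'' 2) j * tripleThetaConst τ m' m'' 4 5 2 *
        (tripleThetaConst τ m' m'' 4 6 2 * tripleThetaConst τ m' m'' 5 6 2)) +
      esgn (∑ i, (m' 4 i + m' 5 i + m' 6 i) * m'' 3 i) *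
      (thetaGrad 3 τ (m' 3) (m'' 3) j * tripleThetaConst τ m' m'' 4 5 3 *
        (tripleThetaConst τ m' m'' 4 6 3 * tripleThetaConst τ m' m'' 5 6 3)) = 0 := by
    intro j
    have := grad_rel4 hτ hA j
    rw [Fin.sum_univ_four] at this
    exact this
  have hsq : ∀ k : ℤ, esgn k * esgn k = 1 := fun k => by
    rw [← esgn_add]; exact esgn_even ⟨k, rfl⟩
  have hexp : Complex.exp (Real.pi * Complex.I *
      ((∑ i, (m' 4 i + m' 5 i + m' 6 i) * (m'' 0 i + m'' 3 i) : ℤ) : ℂ)) =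
      esgn (∑ i, (m' 4 i + m' 5 i + m' 6 i) * m'' 0 i) *
      esgn (∑ i, (m' 4 i + m' 5 i + m' 6 i) * m'' 3 i) := by
    rw [← esgn_add, ← Finset.sum_add_distrib]
    simp only [esgn, mul_add]
  rw [hexp]
  have hs3 := hsq (∑ i, (m' 4 i + m' 5 i + m' 6 i) * m'' 3 i)
  have hden : tripleThetaConst τ m' m'' 4 5 3 * tripleThetaConst τ m' m'' 4 6 3 *
      tripleThetaConst τ m' m'' 5 6 3 ≠ 0 := mul_ne_zero (mul_ne_zero hθ₁ hθ₂) hθ₃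
  rw [div_eq_div_iff hD hden]
  clear hD hden hθ₁ hθ₂ hθ₃ hexp
  have r0 := hrel 0
  have r1 := hrel 1
  have r2 := hrel 2
  clear hrel
  simp only [thetaJacDet, Matrix.det_fin_three, Matrix.of_apply, Matrix.cons_val_zero,
    Matrix.cons_val_one, Matrix.cons_val]
  generalize esgn (∑ i, (m' 4 i + m' 5 i + m' 6 i) * m'' 0 i) = s0 at *
  generalize esgn (∑ i, (m' 4 i + m' 5 i + m' 6 i) * m'' 1 i) = s1 at *
  generalize esgn (∑ i, (m' 4 i + m' 5 i + m' 6 i) * m'' 2 i) = s2 at *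
  generalize esgn (∑ i, (m' 4 i + m' 5 i + m' 6 i) * m'' 3 i) = s3 at *
  generalize tripleThetaConst τ m' m'' 4 5 0 = A0 at *
  generalize tripleThetaConst τ m' m'' 4 6 0 = B0 at *
  generalize tripleThetaConst τ m' m'' 5 6 0 = C0 at *
  generalize tripleThetaConst τ m' m'' 4 5 1 = A1 at *
  generalize tripleThetaConst τ m' m'' 4 6 1 = B1 at *
  generalize tripleThetaConst τ m' m'' 5 6 1 = C1 at *
  generalize tripleThetaConst τ m' m'' 4 5 2 = A2 at *
  generalize tripleThetaConst τ m' m'' 4 6 2 = B2 at *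
  generalize tripleThetaConst τ m' m'' 5 6 2 = C2 at *
  generalize tripleThetaConst τ m' m'' 4 5 3 = A3 at *
  generalize tripleThetaConst τ m' m'' 4 6 3 = B3 at *
  generalize tripleThetaConst τ m' m'' 5 6 3 = C3 at *
  generalize thetaGrad 3 τ (m' 0) (m'' 0) = x at *
  generalize thetaGrad 3 τ (m' 1) (m'' 1) = y at *
  generalize thetaGrad 3 τ (m' 2) (m'' 2) = u at *
  generalize thetaGrad 3 τ (m' 3) (m'' 3) = v at *
  linear_combination s3 * (y 1 * u 2 - y 2 * u 1) * r0 - s3 * (y 0 * u 2 - y 2 * u 0) * r1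
    + s3 * (y 0 * u 1 - y 1 * u 0) * r2
    - A3 * B3 * C3 * (v 0 * (y 1 * u 2 - y 2 * u 1) - v 1 * (y 0 * u 2 - y 2 * u 0)
      + v 2 * (y 0 * u 1 - y 1 * u 0)) * hs3
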